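/- Let N ∈ ℕ, let (m_k)_{k∈ℕ} be a strictly increasing sequence in ℕ with k! dividing m_k for each k ∈ ℕ, and let v_1, …, v_N ∈ ℤ[x] be non-constant, ℚ-linearly independent polynomials with v_j(0) = 0 for each j ∈ {1,…,N}. Then there exist a subsequence (n_k)_{k∈ℕ} of (m_k)_{k∈ℕ} and, for each ξ = (ξ_1,…,ξ_N) ∈ {0,1}^N, a continuous symmetric Borel probability measure σ_ξ on 𝕋 such that for every j ∈ {1,…,N} and every m ∈ ℤ, lim_{k→∞} ∫_𝕋 e^{2πi(v_j(n_k)+m)x} dσ_ξ(x) = (1 − ξ_j) ∫_𝕋 e^{2πimx} dσ_ξ(x). -/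

import Mathlib

open Filter Topology MeasureTheory

noncomputable section

/-- The product of the normalized Haar measures on a torus. -/
def torusHaar (ι : Type*) [Fintype ι] : Measure (UnitAddTorus ι) :=
  Measure.pi fun _ => AddCircle.haarAddCircle

instance (ι : Type*) [Fintype ι] : IsProbabilityMeasure (torusHaar ι) := by
  unfold torusHaar; infer_instance

instance (ι : Type*) [Fintype ι] : (torusHaar ι).IsOpenPosMeasure := by
  unfold torusHaar; infer_instance

theorem integral_mFourier_torusHaar {ι : Type*} [Fintype ι] {a : ι → ℤ} (ha : a ≠ 0) :
    ∫ x, UnitAddTorus.mFourier a x ∂torusHaar ι = 0 := by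
  obtain ⟨i, hi⟩ := Function.ne_iff.1 ha
  have h := integral_fintype_prod_eq_prod (𝕜 := ℂ)
    (f := fun i (x : UnitAddCircle) => (fourier (a i) x : ℂ))
    (μ := fun _ => AddCircle.haarAddCircle)
  refine h.trans (Finset.prod_eq_zero (Finset.mem_univ i) ?_)
  exact integral_eq_zero_of_add_right_eq_neg (μ := AddCircle.haarAddCircle)
    (fourier_add_half_inv_index hi one_pos)

theorem mFourier_coe_mul {ι : Type*} [Fintype ι] (a V : ι → ℤ) (y : ℝ) :
    UnitAddTorus.mFourier a (fun j => ((V j * y : ℝ) : UnitAddCircle)) =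
      Complex.exp ((2 * Real.pi * Complex.I * ((∑ j, a j * V j : ℤ) : ℂ)) * y) := by
  simp only [UnitAddTorus.mFourier, ContinuousMap.coe_mk, fourier_coe_apply]
  rw [← Complex.exp_sum]
  congr 1
  push_cast
  rw [Finset.mul_sum, Finset.sum_mul]
  refine Finset.sum_congr rfl fun j _ => ?_
  ring

theorem continuous_coe_mul {ι : Type*} (V : ι → ℤ) :
    Continuous fun (y : ℝ) (j : ι) => ((V j * y : ℝ) : UnitAddCircle) :=
  continuous_pi fun _ => (AddCircle.continuous_mk' 1).comp (continuous_const.mul continuous_id)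

theorem norm_integral_exp_le {s : ℝ} (hs : s ≠ 0) (b : ℝ) :
    ‖∫ y in (0 : ℝ)..b, Complex.exp ((2 * Real.pi * Complex.I * s) * y)‖ ≤ |s|⁻¹ := by
  have hc : (2 * Real.pi * Complex.I * s : ℂ) ≠ 0 := by simp [hs, Real.pi_ne_zero]
  have hn : ‖(2 * Real.pi * Complex.I * s : ℂ)‖ = 2 * Real.pi * |s| := by
    simp [abs_of_pos Real.pi_pos]
  have he : ∀ t : ℝ, ‖Complex.exp ((2 * Real.pi * Complex.I * s) * t)‖ = 1 := fun t => by
    rw [show (2 * Real.pi * Complex.I * s * t : ℂ) = ((2 * Real.pi * s * t : ℝ) : ℂ) * Complex.I by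
      push_cast; ring]
    exact Complex.norm_exp_ofReal_mul_I _
  rw [integral_exp_mul_complex hc, norm_div, hn, div_le_iff₀ (by positivity)]
  refine (norm_sub_le _ _).trans ?_
  rw [he, he, show |s|⁻¹ * (2 * Real.pi * |s|) = 2 * Real.pi by
    field_simp [abs_ne_zero.2 hs]]
  linarith [Real.pi_gt_three]

theorem tendsto_integral_mFourier {ι : Type*} [Fintype ι] {V : ℕ → ι → ℤ}
    (hV : ∀ a : ι → ℤ, a ≠ 0 → Tendsto (fun n => |((∑ j, a j * V n j : ℤ) : ℝ)|) atTop atTop)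
    (b : ℝ) (a : ι → ℤ) :
    Tendsto (fun n => ∫ y in (0 : ℝ)..b,
      UnitAddTorus.mFourier a (fun j => ((V n j * y : ℝ) : UnitAddCircle))) atTop
      (𝓝 (b * ∫ x, UnitAddTorus.mFourier a x ∂torusHaar ι)) := by
  by_cases ha : a = 0
  · simp [ha, UnitAddTorus.mFourier_zero]
  rw [integral_mFourier_torusHaar ha, mul_zero]
  refine squeeze_zero_norm' ?_ (hV a ha).inv_tendsto_atTop
  filter_upwards [(hV a ha).eventually_gt_atTop 0] with n hn
  simp only [mFourier_coe_mul, Pi.inv_apply]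
  simpa using norm_integral_exp_le (abs_pos.1 hn) b

/-- Weyl equidistribution along a short segment for a sequence of integer vectors that escapes
every rational hyperplane. -/
theorem tendsto_integral_torus {ι : Type*} [Fintype ι] {V : ℕ → ι → ℤ}
    (hV : ∀ a : ι → ℤ, a ≠ 0 → Tendsto (fun n => |((∑ j, a j * V n j : ℤ) : ℝ)|) atTop atTop)
    {b : ℝ} (hb : 0 < b) (f : C(UnitAddTorus ι, ℂ)) :
    Tendsto (fun n => ∫ y in (0 : ℝ)..b,
      f (fun j => ((V n j * y : ℝ) : UnitAddCircle))) atTop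
      (𝓝 (b * ∫ x, f x ∂torusHaar ι)) := by
  have hint : ∀ (g : C(UnitAddTorus ι, ℂ)) n, IntervalIntegrable
      (fun y : ℝ => g (fun j => ((V n j * y : ℝ) : UnitAddCircle))) volume 0 b := fun g n =>
    (g.continuous.comp (continuous_coe_mul (V n))).intervalIntegrable _ _
  have hint' : ∀ g : C(UnitAddTorus ι, ℂ), Integrable g (torusHaar ι) := fun g =>
    g.continuous.integrable_of_hasCompactSupport (HasCompactSupport.of_compactSpace _)
  have hspan : ∀ g ∈ Submodule.span ℂ (Set.range (UnitAddTorus.mFourier (d := ι))),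
      Tendsto (fun n => ∫ y in (0 : ℝ)..b, g (fun j => ((V n j * y : ℝ) : UnitAddCircle))) atTop
      (𝓝 (b * ∫ x, g x ∂torusHaar ι)) := by
    intro g hg
    induction hg using Submodule.span_induction with
    | mem g hg => obtain ⟨a, rfl⟩ := hg; exact tendsto_integral_mFourier hV b a
    | zero => simp
    | add g h _ _ hg hh =>
      simp only [ContinuousMap.add_apply]
      rw [integral_add (hint' g) (hint' h), mul_add]
      refine (hg.add hh).congr fun n => ?_
      rw [intervalIntegral.integral_add (hint g n) (hint h n)]
    | smul c g _ hg =>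
      simp only [ContinuousMap.smul_apply, smul_eq_mul, integral_const_mul,
        intervalIntegral.integral_const_mul]
      rw [mul_left_comm]
      exact hg.const_mul c
  have hf : f ∈ closure
      (Submodule.span ℂ (Set.range (UnitAddTorus.mFourier (d := ι))) : Set C(UnitAddTorus ι, ℂ)) := by
    rw [← Submodule.topologicalClosure_coe, UnitAddTorus.span_mFourier_closure_eq_top]
    trivial
  rw [Metric.tendsto_atTop]
  intro ε hε
  obtain ⟨g, hg, hfg⟩ := Metric.mem_closure_iff.1 hf (ε / (3 * b)) (by positivity)
  obtain ⟨n₀, hn₀⟩ := Metric.tendsto_atTop.1 (hspan g hg) (ε / 3) (by positivity)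
  have hpt : ∀ x, ‖f x - g x‖ ≤ ε / (3 * b) := fun x => by
    rw [← dist_eq_norm]; exact (ContinuousMap.dist_apply_le_dist x).trans hfg.le
  refine ⟨n₀, fun n hn => ?_⟩
  have h1 : dist (∫ y in (0 : ℝ)..b, f (fun j => ((V n j * y : ℝ) : UnitAddCircle)))
      (∫ y in (0 : ℝ)..b, g (fun j => ((V n j * y : ℝ) : UnitAddCircle))) ≤ ε / 3 := by
    rw [dist_eq_norm, ← intervalIntegral.integral_sub (hint f n) (hint g n)]
    refine (intervalIntegral.norm_integral_le_of_norm_le_const fun y _ => hpt _).trans_eq ?_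
    rw [sub_zero, abs_of_pos hb]
    field_simp
  have h2 : dist ((b : ℂ) * ∫ x, g x ∂torusHaar ι) (b * ∫ x, f x ∂torusHaar ι) ≤ ε / 3 := by
    rw [dist_comm, dist_eq_norm, ← mul_sub, ← integral_sub (hint' f) (hint' g), norm_mul,
      Complex.norm_real, Real.norm_of_nonneg hb.le]
    have := norm_integral_le_of_norm_le_const (μ := torusHaar ι) (.of_forall hpt)
    rw [probReal_univ, mul_one] at this
    calc b * _ ≤ b * (ε / (3 * b)) := by gcongr
      _ = ε / 3 := by field_simp
  have h3 := dist_triangle4 (∫ y in (0 : ℝ)..b, f (fun j => ((V n j * y : ℝ) : UnitAddCircle)))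
    (∫ y in (0 : ℝ)..b, g (fun j => ((V n j * y : ℝ) : UnitAddCircle)))
    ((b : ℂ) * ∫ x, g x ∂torusHaar ι) (b * ∫ x, f x ∂torusHaar ι)
  linarith [hn₀ n hn]

/-- Kronecker approximation by small rationals. -/
theorem eventually_exists_rat_approx {ι : Type*} [Fintype ι] {V : ℕ → ι → ℤ}
    (hV : ∀ a : ι → ℤ, a ≠ 0 → Tendsto (fun n => |((∑ j, a j * V n j : ℤ) : ℝ)|) atTop atTop)
    (θ : UnitAddTorus ι) {b ε : ℝ} (hb : 0 < b) (hε : 0 < ε) :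
    ∀ᶠ n in atTop, ∃ c : ℚ, 0 < (c : ℝ) ∧ (c : ℝ) < b ∧
      ∀ j, ‖((V n j * c : ℝ) : UnitAddCircle) - θ j‖ < ε := by
  let F : C(UnitAddTorus ι, ℝ) := ⟨fun x => max 0 (ε - dist x θ), by fun_prop⟩
  let f : C(UnitAddTorus ι, ℂ) := ⟨fun x => (F x : ℂ), by fun_prop⟩
  have hF : 0 < ∫ x, F x ∂torusHaar ι :=
    F.continuous.integral_pos_of_hasCompactSupport_nonneg_nonzero (x := θ)
      (HasCompactSupport.of_compactSpace _) (fun x => le_max_left _ _)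
      (by simp [F, hε.le, hε.ne'])
  have hf : (b : ℂ) * ∫ x, f x ∂torusHaar ι ≠ 0 := by
    have : ∫ x, f x ∂torusHaar ι = ((∫ x, F x ∂torusHaar ι : ℝ) : ℂ) :=
      integral_complex_ofReal
    rw [this]
    exact mul_ne_zero (by exact_mod_cast hb.ne') (by exact_mod_cast hF.ne')
  filter_upwards [(tendsto_integral_torus hV hb f).eventually_ne hf] with n hn
  let U : Set ℝ := Set.Ioo 0 b ∩
    (fun (y : ℝ) j => ((V n j * y : ℝ) : UnitAddCircle)) ⁻¹' Metric.ball θ ε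
  have hU : IsOpen U := isOpen_Ioo.inter (Metric.isOpen_ball.preimage (continuous_coe_mul (V n)))
  have hne : U.Nonempty := by
    by_contra hemp
    apply hn
    rw [intervalIntegral.integral_of_le hb.le, integral_Ioc_eq_integral_Ioo]
    refine setIntegral_eq_zero_of_forall_eq_zero fun y hy => ?_
    by_contra hy0
    refine hemp ⟨y, hy, ?_⟩
    by_contra hfar
    apply hy0
    rw [Set.mem_preimage, Metric.mem_ball, not_lt] at hfar
    simp only [f, F, ContinuousMap.coe_mk]
    rw [max_eq_left (by linarith), Complex.ofReal_zero]
  obtain ⟨c, hc⟩ := Rat.denseRange_cast.exists_mem_open hU hne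
  refine ⟨c, hc.1.1, hc.1.2, fun j => ?_⟩
  rw [← dist_eq_norm]
  exact (dist_pi_lt_iff hε).1 hc.2 j

theorem tendsto_abs_combination {N : ℕ} {m : ℕ → ℕ} (hm : StrictMono m)
    {v : Fin N → Polynomial ℤ}
    (hli : ∀ a : Fin N → ℤ, ∑ j, Polynomial.C (a j) * v j = 0 → a = 0)
    (h0 : ∀ j, (v j).eval 0 = 0) (a : Fin N → ℤ) (ha : a ≠ 0) :
    Tendsto (fun n => |((∑ j, a j * (v j).eval (m n : ℤ) : ℤ) : ℝ)|) atTop atTop := by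
  set w : Polynomial ℤ := ∑ j, Polynomial.C (a j) * v j with hw
  have hw0 : w ≠ 0 := fun h => ha (hli a h)
  have hev : ∀ x : ℤ, w.eval x = ∑ j, a j * (v j).eval x := fun x => by
    simp [hw, Polynomial.eval_finsetSum]
  have hdeg : 0 < w.degree := by
    by_contra! h
    obtain hc := Polynomial.eq_C_of_degree_le_zero h
    have h1 : w.eval 0 = 0 := by simp [hev, h0]
    rw [hc, Polynomial.eval_C] at h1
    rw [h1, Polynomial.C_0] at hc
    exact hw0 hc
  have h := Polynomial.abs_tendsto_atTop (w.map (Int.castRingHom ℝ))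
    (by rwa [Polynomial.degree_map_eq_of_injective (RingHom.injective_int _)])
  refine (h.comp (tendsto_natCast_atTop_atTop.comp hm.tendsto_atTop)).congr fun n => ?_
  rw [← hev]
  have := Polynomial.eval_intCast_map (Int.castRingHom ℝ) w (m n : ℤ)
  simp only [Function.comp_apply, Int.cast_natCast, eq_intCast] at this ⊢
  rw [this]

theorem eventually_dvd_eval {N : ℕ} {m : ℕ → ℕ} (hfac : ∀ k, Nat.factorial k ∣ m k)
    {v : Fin N → Polynomial ℤ} (h0 : ∀ j, (v j).eval 0 = 0) {d : ℕ} (hd : 0 < d) :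
    ∀ᶠ n in atTop, ∀ j, (d : ℤ) ∣ (v j).eval (m n : ℤ) := by
  filter_upwards [eventually_ge_atTop d] with n hn j
  have h1 : (d : ℤ) ∣ m n :=
    Int.natCast_dvd_natCast.2 ((Nat.dvd_factorial hd hn).trans (hfac n))
  have h2 := Polynomial.sub_dvd_eval_sub (m n : ℤ) 0 (v j)
  rw [h0, sub_zero, sub_zero] at h2
  exact h1.trans h2

/-- Inductive choice of times `r k` and, for every target `θ ξ`, of torsion points `c k ξ`: the
frequency at time `r l` kills the earlier points, barely moves the later ones, and sends `c l ξ`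
near `θ ξ`. -/
theorem exists_times_and_points {ι Ξ : Type*} [Fintype ι] [Finite Ξ] {W : ℕ → ι → ℤ}
    (hW : ∀ a : ι → ℤ, a ≠ 0 → Tendsto (fun n => |((∑ j, a j * W n j : ℤ) : ℝ)|) atTop atTop)
    (hdvd : ∀ d : ℕ, 0 < d → ∀ᶠ n in atTop, ∀ j, (d : ℤ) ∣ W n j)
    (θ : Ξ → UnitAddTorus ι) :
    ∃ (r : ℕ → ℕ) (ε : ℕ → ℝ) (c : ℕ → Ξ → UnitAddCircle),
      StrictMono r ∧ (∀ k, 0 < ε k) ∧ (∀ k l, k < l → ε l ≤ ε k / 2) ∧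
      (∀ k ξ, ‖c k ξ‖ ≤ ε k) ∧
      (∀ k ξ j, ‖W (r k) j • c k ξ - θ ξ j‖ ≤ ε k) ∧
      (∀ k l, k < l → ∀ ξ, (2 : ℤ) • c l ξ ≠ (2 : ℤ) • c k ξ) ∧
      (∀ k l, k < l → ∀ ξ j, W (r l) j • c k ξ = 0) ∧
      (∀ k l, k < l → ∀ ξ j, ‖W (r k) j • c l ξ‖ ≤ ε l) := by
  let P : ℕ × ℝ × (Ξ → UnitAddCircle) → Prop := fun x =>
    0 < x.2.1 ∧ ∀ ξ, (∃ d : ℕ, 0 < d ∧ d • x.2.2 ξ = 0) ∧ (2 : ℤ) • x.2.2 ξ ≠ 0 ∧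
      ‖x.2.2 ξ‖ ≤ x.2.1 ∧ ∀ j, ‖W x.1 j • x.2.2 ξ - θ ξ j‖ ≤ x.2.1
  let R : ℕ × ℝ × (Ξ → UnitAddCircle) → ℕ × ℝ × (Ξ → UnitAddCircle) → Prop := fun x y =>
    x.1 < y.1 ∧ y.2.1 ≤ x.2.1 / 2 ∧ ∀ ξ,
      (2 : ℤ) • y.2.2 ξ ≠ (2 : ℤ) • x.2.2 ξ ∧ (∀ j, W y.1 j • x.2.2 ξ = 0) ∧
      ∀ j, ‖W x.1 j • y.2.2 ξ‖ ≤ y.2.1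
  suffices step : ∀ s : Finset (ℕ × ℝ × (Ξ → UnitAddCircle)), (∀ x ∈ s, P x) →
      ∃ y, P y ∧ ∀ x ∈ s, R x y by
    obtain ⟨f, hP, hR⟩ := exists_seq_of_forall_finset_exists P R step
    exact ⟨fun k => (f k).1, fun k => (f k).2.1, fun k => (f k).2.2,
      fun k l h => (hR k l h).1, fun k => (hP k).1,
      fun k l h => (hR k l h).2.1, fun k ξ => ((hP k).2 ξ).2.2.1,
      fun k ξ => ((hP k).2 ξ).2.2.2, fun k l h ξ => ((hR k l h).2.2 ξ).1,
      fun k l h ξ => ((hR k l h).2.2 ξ).2.1, fun k l h ξ => ((hR k l h).2.2 ξ).2.2⟩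
  intro s hs
  have small : ∀ {t : ℝ}, 0 < t → ∀ᶠ ε in 𝓝[>] (0 : ℝ), ε ≤ t := fun ht =>
    (eventually_le_nhds ht).filter_mono nhdsWithin_le_nhds
  obtain ⟨ε, hε, hε0⟩ := (((Filter.eventually_all_finset s).2 fun x hx =>
    small (half_pos (hs x hx).1)).and self_mem_nhdsWithin).exists
  have hε0 : 0 < ε := hε0
  have hδ : ∀ᶠ δ in 𝓝[>] (0 : ℝ), ∀ x ∈ s, ∀ ξ : Ξ, ∀ j,
      |(W x.1 j : ℝ)| * δ ≤ ε := by
    refine (Filter.eventually_all_finset s).2 fun x hx => eventually_all.2 fun ξ =>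
      eventually_all.2 fun j => ?_
    filter_upwards [small (show 0 < ε / (|(W x.1 j : ℝ)| + 1) by positivity), self_mem_nhdsWithin]
      with δ h2 h3
    have h3 : 0 < δ := h3
    rw [le_div_iff₀ (by positivity)] at h2
    nlinarith
  have hδ' : ∀ᶠ δ in 𝓝[>] (0 : ℝ), ∀ x ∈ s, ∀ ξ : Ξ, 2 * δ ≤ ‖(2 : ℤ) • x.2.2 ξ‖ := by
    refine (Filter.eventually_all_finset s).2 fun x hx => eventually_all.2 fun ξ => ?_
    filter_upwards [small (half_pos (norm_pos_iff.2 ((hs x hx).2 ξ).2.1))] with δ h1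
    linarith
  obtain ⟨δ, ⟨⟨⟨h1, h1'⟩, h2⟩, h3⟩, h4⟩ := ((((hδ.and hδ').and (small hε0)).and
    (small (show (0 : ℝ) < 1 / 4 by norm_num))).and self_mem_nhdsWithin).exists
  have hn1 : ∀ᶠ n in atTop, ∀ x ∈ s, x.1 < n ∧ ∀ ξ j, W n j • x.2.2 ξ = 0 := by
    refine (Filter.eventually_all_finset s).2 fun x hx => (eventually_gt_atTop _).and ?_
    refine eventually_all.2 fun ξ => ?_
    obtain ⟨d, hd, hdc⟩ := ((hs x hx).2 ξ).1
    filter_upwards [hdvd d hd] with n hn j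
    obtain ⟨z, hz⟩ := hn j
    rw [hz, mul_comm, mul_smul, natCast_zsmul, hdc, smul_zero]
  have hn2 := eventually_all.2 fun ξ => eventually_exists_rat_approx hW (θ ξ) h4 hε0
  obtain ⟨n, hn, hc⟩ := (hn1.and hn2).exists
  choose c hc0 hcδ hcθ using hc
  have hnorm : ∀ ξ, ‖((c ξ : ℝ) : UnitAddCircle)‖ = c ξ := fun ξ => by
    rw [(AddCircle.norm_coe_eq_abs_iff 1 one_ne_zero).2, abs_of_pos (hc0 ξ)]
    rw [abs_of_pos (hc0 ξ), abs_one]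
    linarith [hcδ ξ]
  have hnorm2 : ∀ ξ, ‖(2 : ℤ) • ((c ξ : ℝ) : UnitAddCircle)‖ = 2 * c ξ := fun ξ => by
    rw [← AddCircle.coe_zsmul, zsmul_eq_mul, (AddCircle.norm_coe_eq_abs_iff 1 one_ne_zero).2]
    · rw [Int.cast_ofNat, abs_of_pos (by linarith [hc0 ξ])]
    · rw [Int.cast_ofNat, abs_of_pos (by linarith [hc0 ξ]), abs_one]
      linarith [hcδ ξ]
  refine ⟨⟨n, ε, fun ξ => ((c ξ : ℝ) : UnitAddCircle)⟩, ⟨hε0, fun ξ => ⟨?_, ?_, ?_, fun j => ?_⟩⟩,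
    fun x hx => ⟨(hn x hx).1, hε x hx, fun ξ => ⟨?_, (hn x hx).2 ξ, fun j => ?_⟩⟩⟩
  · refine ⟨(c ξ).den, (c ξ).den_pos, ?_⟩
    rw [← AddCircle.coe_nsmul, nsmul_eq_mul, AddCircle.coe_eq_zero_iff]
    refine ⟨(c ξ).num, ?_⟩
    rw [zsmul_eq_mul, mul_one]
    exact_mod_cast (Rat.den_mul_eq_num (c ξ)).symm
  · rw [← norm_pos_iff, hnorm2]
    linarith [hc0 ξ]
  · exact (hnorm ξ).trans_le ((hcδ ξ).le.trans h2)
  · rw [← AddCircle.coe_zsmul, zsmul_eq_mul]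
    exact (hcθ ξ j).le
  · intro h
    have := h1' x hx ξ
    rw [← h, hnorm2] at this
    linarith [hcδ ξ]
  · refine (norm_zsmul_le _ _).trans ?_
    rw [hnorm, Int.norm_eq_abs]
    refine le_trans ?_ (h1 x hx ξ j)
    gcongr
    exact (hcδ ξ).le

instance : BorelSpace ℤˣ := by
  have : MeasurableSingletonClass ℤˣ :=
    ⟨fun x => ⟨{(x : ℤ)}, measurableSet_singleton _, by ext; simp [Units.ext_iff]⟩⟩
  infer_instance

/-- The fair coin measure on sequences of signs. -/
def coinMeasure : Measure (ℕ → ℤˣ) := Measure.haarMeasure ⊤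

instance : IsProbabilityMeasure coinMeasure := ⟨Measure.haarMeasure_self⟩

instance : coinMeasure.IsMulLeftInvariant := by unfold coinMeasure; infer_instance

/-- The random signed sum of the points `c l`. -/
def signedSum (c : ℕ → UnitAddCircle) (g : ℕ → ℤˣ) : UnitAddCircle := ∑' l, (g l : ℤ) • c l

theorem norm_coe_units_zsmul {E : Type*} [SeminormedAddCommGroup E] (u : ℤˣ) (x : E) :
    ‖(u : ℤ) • x‖ = ‖x‖ := by
  rcases Int.units_eq_one_or u with rfl | rfl <;> simp

theorem norm_fourier_apply (n : ℤ) (x : UnitAddCircle) : ‖(fourier n x : ℂ)‖ = 1 := by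
  rw [fourier_apply]
  exact Circle.norm_coe _

theorem summable_signed {c : ℕ → UnitAddCircle} {ε : ℕ → ℝ} (hε : Summable ε)
    (hc : ∀ k, ‖c k‖ ≤ ε k)
    (g : ℕ → ℤˣ) : Summable fun l => (g l : ℤ) • c l :=
  Summable.of_norm_bounded hε fun l => (norm_coe_units_zsmul _ _).trans_le (hc l)

theorem continuous_signedSum {c : ℕ → UnitAddCircle} {ε : ℕ → ℝ} (hε : Summable ε)
    (hc : ∀ k, ‖c k‖ ≤ ε k) : Continuous (signedSum c) := by
  refine continuous_tsum (fun l => ?_) hε fun l g => (norm_coe_units_zsmul _ _).trans_le (hc l)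
  exact (continuous_of_discreteTopology (f := fun u : ℤˣ => (u : ℤ) • c l)).comp
    (continuous_apply l)

theorem signedSum_flip {c : ℕ → UnitAddCircle} {ε : ℕ → ℝ} (hε : Summable ε)
    (hc : ∀ k, ‖c k‖ ≤ ε k)
    (g : ℕ → ℤˣ) (k : ℕ) :
    signedSum c (Pi.mulSingle k (-1) * g) = signedSum c g - (g k : ℤ) • (2 : ℤ) • c k := by
  rw [eq_sub_iff_add_eq, ← eq_sub_iff_add_eq', signedSum, signedSum,
    ← (summable_signed hε hc _).tsum_sub (summable_signed hε hc _), tsum_eq_single k]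
  · simp only [Pi.mul_apply, Pi.mulSingle_eq_same]
    push_cast
    module
  · intro l hl
    simp [Pi.mulSingle_eq_of_ne hl]

theorem signedSum_neg {c : ℕ → UnitAddCircle} (g : ℕ → ℤˣ) : signedSum c (-1 * g) = -signedSum c g := by
  simp [signedSum, tsum_neg]

/-- If `u k` kills the points before `k`, barely moves the points after `k`, and barely moves
`c k`, then it sends signed sums to zero. -/
theorem tendsto_zsmul_signedSum {c : ℕ → UnitAddCircle} {ε : ℕ → ℝ} (hε : Summable ε)
    (hc : ∀ k, ‖c k‖ ≤ ε k)
    {u : ℕ → ℤ} (hlate : ∀ k l, k < l → u l • c k = 0)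
    (hearly : ∀ k l, k ≤ l → ‖u k • c l‖ ≤ ε l) (g : ℕ → ℤˣ) :
    Tendsto (fun k => u k • signedSum c g) atTop (𝓝 0) := by
  have h := tendsto_tsum_of_dominated_convergence (𝓕 := atTop)
    (f := fun k l => (g l : ℤ) • u k • c l) (g := fun _ => 0) hε (fun l => ?_)
    (.of_forall fun k l => ?_)
  · rw [tsum_zero] at h
    refine h.congr fun k => ?_
    rw [signedSum, ← (summable_signed hε hc g).tsum_const_smul (u k)]
    exact tsum_congr fun l => smul_comm _ _ _
  · refine tendsto_const_nhds.congr' ?_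
    filter_upwards [eventually_gt_atTop l] with k hk
    rw [hlate l k hk, smul_zero]
  · rw [norm_coe_units_zsmul]
    rcases lt_or_ge l k with h | h
    · rw [hlate l k h, norm_zero]
      exact (norm_nonneg _).trans (hc l)
    · exact hearly k l h

theorem isProbabilityMeasure_map_signedSum {c : ℕ → UnitAddCircle} {ε : ℕ → ℝ} (hε : Summable ε)
    (hc : ∀ k, ‖c k‖ ≤ ε k) :
    IsProbabilityMeasure (coinMeasure.map (signedSum c)) :=
  Measure.isProbabilityMeasure_map (continuous_signedSum hε hc).aemeasurable

theorem integral_fourier_map_signedSum {c : ℕ → UnitAddCircle} {ε : ℕ → ℝ} (hε : Summable ε)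
    (hc : ∀ k, ‖c k‖ ≤ ε k)
    (n : ℤ) :
    ∫ x, fourier n x ∂coinMeasure.map (signedSum c) =
      ∫ g, (fourier n (signedSum c g) : ℂ) ∂coinMeasure :=
  integral_map (continuous_signedSum hε hc).aemeasurable
    (fourier n).continuous.aestronglyMeasurable

theorem integral_fourier_neg_map_signedSum {c : ℕ → UnitAddCircle} {ε : ℕ → ℝ} (hε : Summable ε)
    (hc : ∀ k, ‖c k‖ ≤ ε k)
    (n : ℤ) :
    ∫ x, fourier n x ∂coinMeasure.map (signedSum c) =
      ∫ x, fourier (-n) x ∂coinMeasure.map (signedSum c) := by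
  rw [integral_fourier_map_signedSum hε hc, integral_fourier_map_signedSum hε hc,
    ← integral_mul_left_eq_self _ (-1)]
  congr 1 with g
  rw [signedSum_neg, fourier_apply, fourier_apply, smul_neg, neg_smul]

theorem map_signedSum_singleton {c : ℕ → UnitAddCircle} {ε : ℕ → ℝ} (hε : Summable ε)
    (hc : ∀ k, ‖c k‖ ≤ ε k)
    (hinj : ∀ k l, k < l → (2 : ℤ) • c l ≠ (2 : ℤ) • c k) (t : UnitAddCircle) :
    coinMeasure.map (signedSum c) {t} = 0 := by
  set σ := coinMeasure.map (signedSum c) with hσ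
  have := isProbabilityMeasure_map_signedSum hε hc
  have hmeas := (continuous_signedSum hε hc).measurable
  have hinj' : Function.Injective fun k => (2 : ℤ) • c k := fun k l h => by
    rcases lt_trichotomy k l with hkl | hkl | hkl
    · exact (hinj k l hkl h.symm).elim
    · exact hkl
    · exact (hinj l k hkl h).elim
  have hle : ∀ k, σ {t} ≤ σ {t + (2 : ℤ) • c k} + σ {t - (2 : ℤ) • c k} := fun k => by
    refine le_trans ?_ (measure_union_le _ _)
    rw [hσ, Measure.map_apply hmeas (measurableSet_singleton _),
      Measure.map_apply hmeas ((measurableSet_singleton _).union (measurableSet_singleton _)),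
      ← measure_preimage_mul coinMeasure (Pi.mulSingle k (-1))]
    refine measure_mono fun g hg => ?_
    simp only [Set.mem_preimage, Set.mem_singleton_iff, signedSum_flip hε hc] at hg
    simp only [Set.mem_preimage, Set.mem_union, Set.mem_singleton_iff]
    rcases Int.units_eq_one_or (g k) with h | h <;> rw [h] at hg <;> push_cast at hg
    · left; rw [← hg]; module
    · right; rw [← hg]; module
  have hsmall : ∀ h : ℕ → UnitAddCircle, Function.Injective h →
      Tendsto (fun k => σ {h k}) atTop (𝓝 0) := fun h hh => by
    rw [← Nat.cofinite_eq_atTop]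
    refine ENNReal.tendsto_cofinite_zero_of_tsum_ne_top ?_
    rw [← measure_iUnion (fun i j hij => Set.disjoint_singleton.2 (hh.ne hij))
      fun _ => measurableSet_singleton _]
    exact measure_ne_top _ _
  have h := (hsmall (fun k => t + (2 : ℤ) • c k) fun k l h => hinj' (add_left_cancel h)).add
    (hsmall (fun k => t - (2 : ℤ) • c k) fun k l h => hinj' (sub_right_injective h))
  rw [add_zero] at h
  exact le_antisymm (ge_of_tendsto' h hle) zero_le

theorem tendsto_integral_fourier_of_rigid {c : ℕ → UnitAddCircle} {ε : ℕ → ℝ} (hε : Summable ε)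
    (hc : ∀ k, ‖c k‖ ≤ ε k)
    {u : ℕ → ℤ} (hlate : ∀ k l, k < l → u l • c k = 0)
    (hearly : ∀ k l, k ≤ l → ‖u k • c l‖ ≤ ε l) (q : ℤ) :
    Tendsto (fun k => ∫ x, fourier (u k + q) x ∂coinMeasure.map (signedSum c)) atTop
      (𝓝 (∫ x, fourier q x ∂coinMeasure.map (signedSum c))) := by
  simp only [integral_fourier_map_signedSum hε hc]
  refine tendsto_integral_of_dominated_convergence (fun _ => 1) (fun k => ?_)
    (integrable_const _) (fun k => .of_forall fun g => ?_) (.of_forall fun g => ?_)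
  · exact ((fourier (u k + q)).continuous.comp
      (continuous_signedSum hε hc)).aestronglyMeasurable
  · exact (norm_fourier_apply _ _).le
  · have h := ((fourier (T := 1) 1).continuous.tendsto 0).comp
      (tendsto_zsmul_signedSum hε hc hlate hearly g)
    have h2 := h.mul_const (fourier q (signedSum c g))
    simp only [fourier_eval_zero, one_mul] at h2
    refine h2.congr fun k => ?_
    rw [fourier_add, Function.comp_apply, fourier_apply, one_smul, fourier_apply (n := u k)]

theorem tendsto_integral_fourier_of_antipodal {c : ℕ → UnitAddCircle} {ε : ℕ → ℝ} (hε : Summable ε)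
    (hc : ∀ k, ‖c k‖ ≤ ε k)
    {u : ℕ → ℤ}
    (hu : Tendsto (fun k => u k • c k) atTop (𝓝 ((1 / 4 : ℝ) : UnitAddCircle))) (q : ℤ) :
    Tendsto (fun k => ∫ x, fourier (u k + q) x ∂coinMeasure.map (signedSum c)) atTop (𝓝 0) := by
  simp only [integral_fourier_map_signedSum hε hc]
  have hc0 : Tendsto c atTop (𝓝 0) := squeeze_zero_norm hc hε.tendsto_atTop_zero
  have hz : Tendsto (fun k => (fourier (u k + q) ((2 : ℤ) • c k) : ℂ)) atTop (𝓝 (-1)) := by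
    have h1 : Tendsto (fun k => (2 : ℤ) • (u k • c k + q • c k)) atTop
        (𝓝 ((2 : ℤ) • (((1 / 4 : ℝ) : UnitAddCircle) + q • 0))) :=
      (hu.add (hc0.const_smul q)).const_smul 2
    have h2 := ((fourier (T := 1) 1).continuous.tendsto _).comp h1
    have hval : (fourier 1 ((2 : ℤ) • (((1 / 4 : ℝ) : UnitAddCircle) + q • 0)) : ℂ) = -1 := by
      rw [smul_zero, add_zero, ← AddCircle.coe_zsmul, fourier_coe_apply, ← Complex.exp_pi_mul_I]
      congr 1
      push_cast
      ring
    rw [hval] at h2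
    refine h2.congr fun k => ?_
    rw [Function.comp_apply, fourier_apply, fourier_apply, one_smul, smul_comm, add_smul]
  have hbound : ∀ k, ‖∫ g, (fourier (u k + q) (signedSum c g) : ℂ) ∂coinMeasure‖ ≤
      ‖1 + (fourier (u k + q) ((2 : ℤ) • c k) : ℂ)‖ := fun k => by
    set n := u k + q
    have hcont : Continuous fun g => (fourier n (signedSum c g) : ℂ) :=
      (fourier n).continuous.comp (continuous_signedSum hε hc)
    have hint : ∀ f : (ℕ → ℤˣ) → ℂ, Continuous f → Integrable f coinMeasure := fun f hf =>
      hf.integrable_of_hasCompactSupport (HasCompactSupport.of_compactSpace _)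
    have hI := integral_mul_left_eq_self (μ := coinMeasure)
      (fun g => (fourier n (signedSum c g) : ℂ)) (Pi.mulSingle k (-1))
    have h2 : (2 : ℂ) * ∫ g, (fourier n (signedSum c g) : ℂ) ∂coinMeasure =
        ∫ g, ((fourier n (signedSum c g) : ℂ) +
          fourier n (signedSum c (Pi.mulSingle k (-1) * g))) ∂coinMeasure := by
      have hcont' := hcont.comp (continuous_const_mul (Pi.mulSingle k (-1)))
      rw [two_mul]
      nth_rw 2 [← hI]
      exact (integral_add (hint _ hcont) (hint _ hcont')).symm
    have h3 : ∀ g, ‖(fourier n (signedSum c g) : ℂ) +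
        fourier n (signedSum c (Pi.mulSingle k (-1) * g))‖ ≤
        ‖1 + (fourier n ((2 : ℤ) • c k) : ℂ)‖ := fun g => by
      have hadd : ∀ x y : UnitAddCircle, (fourier n (x + y) : ℂ) = fourier n x * fourier n y := by
        simp [fourier_apply, AddCircle.toCircle_add]
      have hneg : ∀ x : UnitAddCircle,
          (fourier n (-x) : ℂ) = (starRingEnd ℂ) (fourier n x) := fun x => by
        rw [← fourier_neg, fourier_apply, fourier_apply, smul_neg, neg_smul]
      rw [signedSum_flip hε hc, sub_eq_add_neg, hadd, ← mul_one_add, norm_mul, norm_fourier_apply, one_mul]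
      refine le_of_eq ?_
      rcases Int.units_eq_one_or (g k) with h | h <;> rw [h]
      · rw [Units.val_one, one_smul, hneg, ← RCLike.norm_conj]
        simp
      · simp
    have h4 := norm_integral_le_of_norm_le_const (μ := coinMeasure) (.of_forall h3)
    rw [← h2, probReal_univ, mul_one, norm_mul, Complex.norm_two] at h4
    linarith [norm_nonneg (∫ g, (fourier n (signedSum c g) : ℂ) ∂coinMeasure)]
  refine squeeze_zero_norm hbound ?_
  have := (hz.const_add 1).norm
  rwa [add_neg_cancel, norm_zero] at this

/-- Let `(m_k)` be strictly increasing with `k! ∣ m_k`, and let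
`v_1,…,v_N ∈ ℤ[x]` be non-constant, ℚ-linearly independent, with `v_j(0)=0`. Then
there are a subsequence `(n_k) = (m_{r_k})` and, for each `ξ ∈ {0,1}^N`, a continuous
(atomless) symmetric Borel probability measure `σ_ξ` on `𝕋 = ℝ/ℤ` with
`∫ e^{2πi(v_j(n_k)+m)x} dσ_ξ → (1-ξ_j) ∫ e^{2πimx} dσ_ξ` for every `j` and `m ∈ ℤ`.
Here `fourier n x = e^{2πinx}` on `UnitAddCircle = ℝ/ℤ`. -/
theorem stmt_11 (N : ℕ) (m : ℕ → ℕ) (hm : StrictMono m)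
    (hfac : ∀ k, Nat.factorial k ∣ m k)
    (v : Fin N → Polynomial ℤ) (hnc : ∀ j, 0 < (v j).natDegree)
    (hli : ∀ a : Fin N → ℤ, ∑ j, Polynomial.C (a j) * v j = 0 → a = 0)
    (h0 : ∀ j, (v j).eval 0 = 0) :
    ∃ r : ℕ → ℕ, StrictMono r ∧
      ∀ ξ : Fin N → ℝ, (∀ j, ξ j = 0 ∨ ξ j = 1) →
        ∃ σ : Measure UnitAddCircle, IsProbabilityMeasure σ ∧
          (∀ x : UnitAddCircle, σ {x} = 0) ∧
          (∀ n : ℤ, ∫ x, fourier n x ∂σ = ∫ x, fourier (-n) x ∂σ) ∧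
          (∀ j : Fin N, ∀ q : ℤ,
            Tendsto (fun k => ∫ x, fourier ((v j).eval ((m (r k) : ℤ)) + q) x ∂σ) atTop
              (𝓝 (((1 - ξ j : ℝ) : ℂ) * ∫ x, fourier q x ∂σ))) := by
  let θ : (Fin N → Bool) → UnitAddTorus (Fin N) := fun b j =>
    if b j then ((1 / 4 : ℝ) : UnitAddCircle) else 0
  obtain ⟨r, ε, c, hr, hε0, hε, hc, hcθ, hinj, hlate, hearly⟩ := exists_times_and_points
    (W := fun n j => (v j).eval (m n : ℤ)) (tendsto_abs_combination hm hli h0)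
    (fun d hd => eventually_dvd_eval hfac h0 hd) θ
  have hgeom : ∀ k, ε k ≤ ε 0 * (1 / 2) ^ k := fun k => by
    induction k with
    | zero => simp
    | succ k ih =>
      rw [pow_succ]
      linarith [hε k (k + 1) k.lt_succ_self]
  have hsum : Summable ε := Summable.of_nonneg_of_le (fun k => (hε0 k).le) hgeom
    (summable_geometric_two.mul_left _)
  refine ⟨r, hr, fun ξ hξ => ?_⟩
  let b : Fin N → Bool := fun j => decide (ξ j = 1)
  have hcb : ∀ k, ‖c k b‖ ≤ ε k := fun k => hc k b
  refine ⟨coinMeasure.map (signedSum fun k => c k b),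
    isProbabilityMeasure_map_signedSum hsum hcb,
    map_signedSum_singleton hsum hcb fun k l h => hinj k l h b,
    integral_fourier_neg_map_signedSum hsum hcb, fun j q => ?_⟩
  rcases hξ j with h | h
  · have hθ : θ b j = 0 := by simp [θ, b, h]
    rw [h, sub_zero, Complex.ofReal_one, one_mul]
    refine tendsto_integral_fourier_of_rigid hsum hcb (fun k l hkl => hlate k l hkl b j)
      (fun k l hkl => ?_) q
    rcases hkl.eq_or_lt with rfl | hkl
    · simpa [hθ] using hcθ k b j
    · exact hearly k l hkl b j
  · have hθ : θ b j = ((1 / 4 : ℝ) : UnitAddCircle) := by simp [θ, b, h]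
    rw [h, sub_self, Complex.ofReal_zero, zero_mul]
    refine tendsto_integral_fourier_of_antipodal hsum hcb ?_ q
    rw [← hθ, tendsto_iff_norm_sub_tendsto_zero]
    exact squeeze_zero (fun _ => norm_nonneg _) (fun k => hcθ k b j) hsum.tendsto_atTop_zero
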